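/- arXiv:2212.13549 — 3 statements merged into one kernel-verified Lean document; each statement's English description precedes it below -/
import Mathlib

section
/- Let (M,d) be a bounded metric space with metric normal structure such that the family A(M) of admissible subsets is compact, and let S be a group acting on M by self-maps, each of which is orbit-nonexpansive. Then there exists x ∈ M such that s(x) = x for all s ∈ S. -/
open Metric Set

/-- The orbit of `x` under `T`: `{x} ∪ {Tⁿ x : n ≥ 1}`. -/
def orbitOf {M : Type*} (T : M → M) (x : M) : Set M :=
  Set.range fun n : ℕ => T^[n] x

/-- `D(x,A) = sup { d(x,a) : a ∈ A }`. -/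
noncomputable def Dsup {M : Type*} [MetricSpace M] (x : M) (A : Set M) : ℝ :=
  sSup (dist x '' A)

/-- A self-map `T` is orbit-nonexpansive if `d(Tx,Ty) ≤ D(x, o_T(y))` for all `x,y`. -/
def OrbitNonexpansive {M : Type*} [MetricSpace M] (T : M → M) : Prop :=
  ∀ x y : M, dist (T x) (T y) ≤ Dsup x (orbitOf T y)

/-- A set is admissible if it is an intersection of closed balls. -/
def Admissible {M : Type*} [MetricSpace M] (A : Set M) : Prop :=
  ∃ C : Set (M × ℝ), A = ⋂ p ∈ C, Metric.closedBall p.1 p.2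

/-- The family of admissible sets is compact: any collection of admissible sets whose
finite subcollections have nonempty intersection has nonempty intersection. -/
def AdmissibleCompact (M : Type*) [MetricSpace M] : Prop :=
  ∀ 𝒞 : Set (Set M), (∀ A ∈ 𝒞, Admissible A) →
    (∀ 𝒟 ⊆ 𝒞, 𝒟.Finite → (⋂₀ 𝒟).Nonempty) → (⋂₀ 𝒞).Nonempty

/-- Metric normal structure: every admissible set with more than one point contains a
point `z` with `D(z,A) < δ(A)`. -/
def MetricNormalStructure (M : Type*) [MetricSpace M] : Prop :=
  ∀ A : Set M, Admissible A → A.Nontrivial → ∃ z ∈ A, Dsup z A < Metric.diam A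

/-- `D` is a one-local retract of `M`: any family of closed balls centered in `D` with
nonempty intersection meets `D`. -/
def OneLocalRetract {M : Type*} [MetricSpace M] (D : Set M) : Prop :=
  ∀ C : Set (M × ℝ), (∀ p ∈ C, p.1 ∈ D) →
    (⋂ p ∈ C, Metric.closedBall p.1 p.2).Nonempty →
    ((⋂ p ∈ C, Metric.closedBall p.1 p.2) ∩ D).Nonempty

/-- A family `F` of self-maps is interlaced orbit-nonexpansive if
`d(Tx,Sy) ≤ sup { D(x, o_R(y)) : R ∈ F }` for all `T,S ∈ F` and `x,y ∈ M`. -/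
def InterlacedFamily {M : Type*} [MetricSpace M] (F : Set (M → M)) : Prop :=
  ∀ T ∈ F, ∀ S ∈ F, ∀ x y : M,
    dist (T x) (S y) ≤ sSup ((fun R => Dsup x (orbitOf R y)) '' F)

/-- `B[A,r] = ⋂_{x ∈ A} B̄(x,r)`. -/
def Bball {M : Type*} [MetricSpace M] (A : Set M) (r : ℝ) : Set M :=
  ⋂ x ∈ A, Metric.closedBall x r

theorem Admissible.sInter {M : Type*} [MetricSpace M] {c : Set (Set M)}
    (hc : ∀ A ∈ c, Admissible A) : Admissible (⋂₀ c) := by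
  refine ⟨{p | ∃ A ∈ c, A ⊆ Metric.closedBall p.1 p.2}, Subset.antisymm ?_ ?_⟩
  · intro x hx
    refine mem_iInter₂.2 fun p hp => ?_
    obtain ⟨A, hA, hAp⟩ := hp
    exact hAp (hx A hA)
  · intro x hx A hA
    obtain ⟨C, rfl⟩ := hc A hA
    exact mem_iInter₂.2 fun p hp =>
      mem_iInter₂.1 hx p ⟨_, hA, fun y hy => mem_iInter₂.1 hy p hp⟩

theorem admissible_Bball {M : Type*} [MetricSpace M] (A : Set M) (r : ℝ) :
    Admissible (Bball A r) := by
  refine ⟨(fun x => (x, r)) '' A, ?_⟩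
  simp [Bball]

theorem mem_Bball {M : Type*} [MetricSpace M] {A : Set M} {r : ℝ} {w : M} :
    w ∈ Bball A r ↔ ∀ a ∈ A, dist w a ≤ r := by
  simp [Bball]

theorem dist_le_Dsup {M : Type*} [MetricSpace M]
    (hM : Bornology.IsBounded (Set.univ : Set M)) {A : Set M} (x : M) {a : M} (ha : a ∈ A) :
    dist x a ≤ Dsup x A := by
  refine le_csSup ⟨Metric.diam (univ : Set M), ?_⟩ (mem_image_of_mem _ ha)
  rintro _ ⟨b, -, rfl⟩
  exact Metric.dist_le_diam_of_mem hM (mem_univ _) (mem_univ _)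

theorem orbitOf_subset {M : Type*} {T : M → M} {A : Set M} (hA : MapsTo T A A) {x : M}
    (hx : x ∈ A) : orbitOf T x ⊆ A := by
  rintro _ ⟨n, rfl⟩
  exact hA.iterate n hx

theorem OrbitNonexpansive.mapsTo_Bball {M : Type*} [MetricSpace M] {T : M → M}
    (hT : OrbitNonexpansive T) {A : Set M} (hA : MapsTo T A A) (hsurj : SurjOn T A A) (r : ℝ) :
    MapsTo T (Bball A r) (Bball A r) := by
  intro w hw
  rw [mem_Bball] at hw ⊢
  intro a ha
  obtain ⟨b, hb, rfl⟩ := hsurj ha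
  refine (hT w b).trans (csSup_le ⟨_, mem_image_of_mem _ ⟨0, rfl⟩⟩ ?_)
  rintro _ ⟨c, hc, rfl⟩
  exact hw c (orbitOf_subset hA hb hc)

theorem AdmissibleCompact.sInter_nonempty_of_isChain {M : Type*} [MetricSpace M] [Nonempty M]
    (hcompact : AdmissibleCompact M) {c : Set (Set M)} (hc : ∀ A ∈ c, Admissible A)
    (hne : ∀ A ∈ c, A.Nonempty) (hchain : IsChain (· ⊆ ·) c) : (⋂₀ c).Nonempty := by
  refine hcompact c hc fun D hD hfin => ?_
  rcases D.eq_empty_or_nonempty with rfl | hDne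
  · simp
  obtain ⟨m, hm⟩ := hfin.exists_minimal hDne
  refine (hne m (hD hm.prop)).mono fun x hx A hA => ?_
  rcases hchain.total (hD hm.prop) (hD hA) with h | h
  · exact h hx
  · exact hm.le_of_le hA h hx

/-- A minimal nonempty admissible set among those invariant under a family of self-maps. -/
theorem AdmissibleCompact.exists_minimal_invariant {M : Type*} [MetricSpace M] [Nonempty M]
    (hcompact : AdmissibleCompact M) {ι : Type*} (f : ι → M → M) :
    ∃ A : Set M, Minimal
      (· ∈ {A : Set M | Admissible A ∧ A.Nonempty ∧ ∀ i, MapsTo (f i) A A}) A := by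
  refine zorn_superset _ fun c hc hchain => ⟨⋂₀ c, ⟨?_, ?_, ?_⟩, fun A hA => sInter_subset_of_mem hA⟩
  · exact Admissible.sInter fun A hA => (hc hA).1
  · exact hcompact.sInter_nonempty_of_isChain (fun A hA => (hc hA).1) (fun A hA => (hc hA).2.1)
      hchain
  · exact fun i x hx A hA => (hc hA).2.2 i (hx A hA)

theorem stmt2 {M : Type*} [MetricSpace M] [Nonempty M]
    (hM : Bornology.IsBounded (Set.univ : Set M))
    (hns : MetricNormalStructure M) (hcompact : AdmissibleCompact M)
    {G : Type*} [Group G] (act : G → M → M)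
    (hid : ∀ x : M, act 1 x = x)
    (hcomp : ∀ s t : G, ∀ x : M, act (s * t) x = act s (act t x))
    (hone : ∀ s : G, OrbitNonexpansive (act s)) :
    ∃ x : M, ∀ s : G, act s x = x := by
  obtain ⟨A, hmin⟩ := hcompact.exists_minimal_invariant act
  obtain ⟨hadm, ⟨x, hx⟩, hinv⟩ := hmin.prop
  rcases A.subsingleton_or_nontrivial with hsub | hnt
  · exact ⟨x, fun s => hsub (hinv s hx) hx⟩
  exfalso
  obtain ⟨z, hz, hlt⟩ := hns A hadm hnt
  have hsurj (s : G) : SurjOn (act s) A A := fun a ha =>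
    ⟨act s⁻¹ a, hinv _ ha, by rw [← hcomp, mul_inv_cancel, hid]⟩
  have hadm' : Admissible (A ∩ Bball A (Dsup z A)) := by
    rw [← sInter_pair]
    refine Admissible.sInter ?_
    rintro _ (rfl | rfl)
    exacts [hadm, admissible_Bball _ _]
  have hle : A ⊆ A ∩ Bball A (Dsup z A) := hmin.le_of_le
    ⟨hadm', ⟨z, hz, mem_Bball.2 fun a ha => dist_le_Dsup hM z ha⟩,
      fun s => (hinv s).inter_inter ((hone s).mapsTo_Bball (hinv s) (hsurj s) _)⟩
    inter_subset_left
  refine hlt.not_ge (Metric.diam_le_of_forall_dist_le ?_ fun a ha b hb =>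
    mem_Bball.1 (hle ha).2 b hb)
  exact dist_nonneg.trans (dist_le_Dsup hM z hz)
end

section
/- Let (M,d) be a bounded metric space with metric normal structure such that the family A(M) of admissible subsets is compact. Then any commuting family (T_i)_{i∈I} of orbit-nonexpansive self-maps of M has a common fixed point; moreover, the set of common fixed points is a one-local retract of M. -/
open Metric Set

/-- The intersection of all closed balls centered in `H` that contain `A`. -/
def ballHull {M : Type*} [MetricSpace M] (H A : Set M) : Set M :=
  {y | ∀ x ∈ H, ∀ r : ℝ, A ⊆ closedBall x r → y ∈ closedBall x r}

/-- `A` is an intersection of `H` with closed balls centered in `H`. -/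
def AdmissibleIn {M : Type*} [MetricSpace M] (H A : Set M) : Prop :=
  A ⊆ H ∧ H ∩ ballHull H A ⊆ A

section BallHull

variable {M : Type*} [MetricSpace M] {H K A B : Set M}

theorem subset_ballHull : A ⊆ ballHull H A := fun _ ha _ _ _ h => h ha

theorem ballHull_mono (h : A ⊆ B) : ballHull H A ⊆ ballHull H B :=
  fun _ hy x hx r hr => hy x hx r (h.trans hr)

theorem ballHull_anti (h : H ⊆ K) : ballHull K A ⊆ ballHull H A :=
  fun _ hy x hx r hr => hy x (h hx) r hr

theorem admissible_ballHull (H A : Set M) : Admissible (ballHull H A) := by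
  refine ⟨{p | p.1 ∈ H ∧ A ⊆ closedBall p.1 p.2}, ?_⟩
  ext y
  simp only [ballHull, mem_ofPred_eq, mem_iInter, and_imp, Prod.forall]
  exact ⟨fun h x r hx hr => h x hx r hr, fun h x hx r hr => h x r hx hr⟩

theorem AdmissibleIn.inter_closedBall (hA : AdmissibleIn H A) {x : M} (hx : x ∈ H) (r : ℝ) :
    AdmissibleIn H (A ∩ closedBall x r) :=
  ⟨inter_subset_left.trans hA.1, fun _ hy =>
    ⟨hA.2 ⟨hy.1, ballHull_mono inter_subset_left hy.2⟩, hy.2 x hx r inter_subset_right⟩⟩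

theorem AdmissibleIn.centers (hA : AdmissibleIn H A) (r : ℝ) :
    AdmissibleIn H {x ∈ A | A ⊆ closedBall x r} := by
  refine ⟨fun x hx => hA.1 hx.1, fun y hy => ⟨hA.2 ⟨hy.1, ballHull_mono (sep_subset _ _) hy.2⟩,
    fun a ha => ?_⟩⟩
  rw [mem_closedBall_comm]
  exact hy.2 a (hA.1 ha) r fun x hx => mem_closedBall_comm.1 (hx.2 ha)

theorem admissibleIn_inter_ballHull (H A : Set M) : AdmissibleIn H (H ∩ ballHull H A) :=
  ⟨inter_subset_left, fun _ hy => ⟨hy.1, fun x hx r hr =>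
    hy.2 x hx r fun _ hz => hz.2 x hx r hr⟩⟩

theorem admissibleIn_sInter {𝒞 : Set (Set M)} (hne : 𝒞.Nonempty)
    (h𝒞 : ∀ A ∈ 𝒞, AdmissibleIn H A) : AdmissibleIn H (⋂₀ 𝒞) := by
  obtain ⟨A, hA⟩ := hne
  exact ⟨(sInter_subset_of_mem hA).trans (h𝒞 A hA).1, fun y hy B hB =>
    (h𝒞 B hB).2 ⟨hy.1, ballHull_mono (sInter_subset_of_mem hB) hy.2⟩⟩

theorem admissibleIn_inter_iInter_closedBall {C : Set (M × ℝ)} (hC : ∀ p ∈ C, p.1 ∈ H) :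
    AdmissibleIn H ((⋂ p ∈ C, closedBall p.1 p.2) ∩ H) :=
  ⟨inter_subset_right, fun _ hy => ⟨mem_iInter₂.2 fun p hp =>
    hy.2 p.1 (hC p hp) p.2 fun _ hz => mem_iInter₂.1 hz.1 p hp, hy.1⟩⟩

/-- A one-local retract inherits the finite intersection property, for chains. -/
theorem OneLocalRetract.sInter_nonempty [Nonempty M] (hcompact : AdmissibleCompact M)
    (hH : OneLocalRetract H) {𝒞 : Set (Set M)} (hchain : IsChain (· ⊆ ·) 𝒞)
    (h𝒞 : ∀ A ∈ 𝒞, AdmissibleIn H A) (hne : ∀ A ∈ 𝒞, A.Nonempty) : (⋂₀ 𝒞).Nonempty := by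
  have hhull : (⋂₀ (ballHull H '' 𝒞)).Nonempty := by
    refine hcompact _ (forall_mem_image.2 fun A _ => admissible_ballHull H A) fun 𝒟 h𝒟 hfin => ?_
    obtain rfl | h𝒟ne := 𝒟.eq_empty_or_nonempty
    · simp
    obtain ⟨D, hD⟩ := hfin.exists_minimal h𝒟ne
    obtain ⟨A, hA, rfl⟩ := h𝒟 hD.prop
    obtain ⟨a, ha⟩ := hne A hA
    refine ⟨a, fun E hE => ?_⟩
    obtain ⟨B, hB, rfl⟩ := h𝒟 hE
    obtain h | h := hchain.total hA hB
    · exact subset_ballHull (h ha)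
    · exact hD.le_of_le hE (ballHull_mono h) (subset_ballHull ha)
  obtain ⟨z, hz⟩ := hhull
  obtain ⟨y, hy, hyH⟩ := hH {p | p.1 ∈ H ∧ ∃ A ∈ 𝒞, A ⊆ closedBall p.1 p.2} (fun p hp => hp.1)
    ⟨z, mem_iInter₂.2 fun p ⟨hp, A, hA, hAp⟩ => hz _ (mem_image_of_mem _ hA) p.1 hp p.2 hAp⟩
  exact ⟨y, fun A hA => (h𝒞 A hA).2 ⟨hyH, fun x hx r hr =>
    mem_iInter₂.1 hy (x, r) ⟨hx, A, hA, hr⟩⟩⟩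

theorem OneLocalRetract.centers_nonempty (hH : OneLocalRetract H) (hA : AdmissibleIn H A)
    {z : M} (hz : z ∈ ballHull H A) {r : ℝ} (hr : A ⊆ closedBall z r) :
    {x ∈ A | A ⊆ closedBall x r}.Nonempty := by
  set C : Set (M × ℝ) := {p | p.1 ∈ H ∧ (A ⊆ closedBall p.1 p.2 ∨ p.1 ∈ A ∧ p.2 = r)}
  have hzC : z ∈ ⋂ p ∈ C, closedBall p.1 p.2 := by
    refine mem_iInter₂.2 ?_
    rintro ⟨x, s⟩ ⟨hx, hs | ⟨ha, rfl⟩⟩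
    · exact hz x hx s hs
    · exact mem_closedBall_comm.1 (hr ha)
  obtain ⟨y, hy, hyH⟩ := hH C (fun p hp => hp.1) ⟨z, hzC⟩
  refine ⟨y, hA.2 ⟨hyH, fun x hx s hs => mem_iInter₂.1 hy (x, s) ⟨hx, .inl hs⟩⟩, fun a ha => ?_⟩
  exact mem_closedBall_comm.1 (mem_iInter₂.1 hy (a, r) ⟨hA.1 ha, .inr ⟨ha, rfl⟩⟩)

theorem oneLocalRetract_univ : OneLocalRetract (univ : Set M) := fun _ _ h => by
  rwa [inter_univ]

theorem MetricNormalStructure.exists_center (hM : Bornology.IsBounded (univ : Set M))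
    (hns : MetricNormalStructure M) (hA : A.Nontrivial) :
    ∃ z ∈ ballHull univ A, ∃ r, A ⊆ closedBall z r ∧ ∃ a ∈ A, ¬ A ⊆ closedBall a r := by
  obtain ⟨z, hz, hlt⟩ := hns _ (admissible_ballHull univ A) (hA.mono subset_ballHull)
  have hzA : ∀ a ∈ A, dist z a ≤ Dsup z (ballHull univ A) := fun a ha => by
    refine le_csSup ⟨diam (univ : Set M), ?_⟩ (mem_image_of_mem _ (subset_ballHull ha))
    exact forall_mem_image.2 fun b _ => dist_le_diam_of_mem hM (mem_univ z) (mem_univ b)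
  refine ⟨z, hz, _, fun a ha => mem_closedBall'.2 (hzA a ha), ?_⟩
  by_contra! hall
  obtain ⟨a, ha⟩ := hA.nonempty
  refine hlt.not_ge (diam_le_of_forall_dist_le (dist_nonneg.trans (hzA a ha)) fun x hx y hy => ?_)
  exact mem_closedBall'.1 <| hy x (mem_univ x) _ fun b hb =>
    mem_closedBall_comm.1 (hx b (mem_univ b) _ (hall b hb))

end BallHull

theorem orbitOf_subset_of_mapsTo {M : Type*} {T : M → M} {A : Set M} (hT : MapsTo T A A) {x : M}
    (hx : x ∈ A) : orbitOf T x ⊆ A :=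
  range_subset_iff.2 fun n => hT.iterate n hx

section FixedPoints

variable {M : Type*} [MetricSpace M] {H : Set M} {T : M → M}

theorem OrbitNonexpansive.dist_le (hT : OrbitNonexpansive T) {x y : M} {r : ℝ}
    (h : orbitOf T y ⊆ closedBall x r) : dist (T x) (T y) ≤ r :=
  (hT x y).trans <| csSup_le ((range_nonempty _).image _) <|
    forall_mem_image.2 fun _ hz => mem_closedBall'.1 (h hz)

theorem OneLocalRetract.inter_fixedPoints [Nonempty M]
    (hM : Bornology.IsBounded (univ : Set M)) (hns : MetricNormalStructure M)
    (hcompact : AdmissibleCompact M) (hH : OneLocalRetract H) (hTH : MapsTo T H H)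
    (hT : OrbitNonexpansive T) : OneLocalRetract (H ∩ {x | T x = x}) := by
  intro C hC hCne
  set X := (⋂ p ∈ C, closedBall p.1 p.2) ∩ H
  obtain ⟨A, hAX, hA⟩ := zorn_superset_nonempty
    {A | A.Nonempty ∧ AdmissibleIn H A ∧ MapsTo T A A} (fun c hc hchain hcne =>
      ⟨⋂₀ c, ⟨hH.sInter_nonempty hcompact hchain (fun B hB => (hc hB).2.1) fun B hB => (hc hB).1,
        admissibleIn_sInter hcne fun B hB => (hc hB).2.1,
        fun x hx B hB => (hc hB).2.2 (hx B hB)⟩, fun B hB => sInter_subset_of_mem hB⟩) X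
    ⟨hH C (fun p hp => (hC p hp).1) hCne,
      admissibleIn_inter_iInter_closedBall fun p hp => (hC p hp).1, fun x hx => by
        refine ⟨mem_iInter₂.2 fun p hp => ?_, hTH hx.2⟩
        have hfix : T p.1 = p.1 := (hC p hp).2
        have horbit : orbitOf T p.1 ⊆ closedBall x p.2 := by
          rintro _ ⟨n, rfl⟩
          simp only [Function.iterate_fixed hfix n]
          exact mem_closedBall_comm.1 (mem_iInter₂.1 hx.1 p hp)
        have := hT.dist_le horbit
        rwa [hfix] at this⟩
  obtain ⟨hne, hadm, hmaps⟩ := hA.prop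
  have himage : ∀ x ∈ H, ∀ r, MapsTo T A (closedBall x r) → A ⊆ closedBall x r := by
    have hsub : H ∩ ballHull H (T '' A) ⊆ A :=
      (inter_subset_inter_right _ (ballHull_mono hmaps.image_subset)).trans hadm.2
    have hTA : MapsTo T A (H ∩ ballHull H (T '' A)) := fun x hx =>
      ⟨hadm.1 (hmaps hx), subset_ballHull (mem_image_of_mem T hx)⟩
    have hle : A ⊆ H ∩ ballHull H (T '' A) := hA.le_of_le
      ⟨hne.elim fun x hx => ⟨T x, hTA hx⟩, admissibleIn_inter_ballHull H _, hTA.mono_left hsub⟩ hsub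
    exact fun x hx r hr a ha => (hle ha).2 x hx r hr.image_subset
  have hsing : A.Subsingleton := by
    by_contra hA'
    obtain ⟨z, hz, r, hzr, a, ha, har⟩ := hns.exists_center hM (not_subsingleton_iff.1 hA')
    have hle : A ⊆ {x ∈ A | A ⊆ closedBall x r} := hA.le_of_le
      ⟨hH.centers_nonempty hadm (ballHull_anti (subset_univ H) hz) hzr, hadm.centers r,
        fun x hx => ⟨hmaps hx.1, himage _ (hadm.1 (hmaps hx.1)) r fun y hy =>
          mem_closedBall'.2 (hT.dist_le ((orbitOf_subset_of_mapsTo hmaps hy).trans hx.2))⟩⟩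
      (sep_subset _ _)
    exact har (hle ha).2
  obtain ⟨a, ha⟩ := hne
  exact ⟨a, (hAX ha).1, (hAX ha).2, hsing (hmaps ha) ha⟩

end FixedPoints

/-- The families of sets `A H`, indexed by `H ∈ 𝓗`, that are monotone in `H` and such that `A H` is
nonempty and admissible in `H`. -/
def monotoneAdmissibleFamilies {M : Type*} [MetricSpace M] (𝓗 : Set (Set M)) :
    Set (Set M → Set M) :=
  {A | (∀ H ∈ 𝓗, (A H).Nonempty) ∧ (∀ H ∈ 𝓗, AdmissibleIn H (A H)) ∧ MonotoneOn A 𝓗}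

section Chains

variable {M : Type*} [MetricSpace M] {𝓗 : Set (Set M)}

theorem exists_minimal_monotoneAdmissibleFamily [Nonempty M] (hcompact : AdmissibleCompact M)
    (h𝓗 : ∀ H ∈ 𝓗, OneLocalRetract H) {X : Set M → Set M}
    (hX : X ∈ monotoneAdmissibleFamilies 𝓗) :
    ∃ A ≤ X, Minimal (· ∈ monotoneAdmissibleFamilies 𝓗) A := by
  refine zorn_le_nonempty₀ (α := (Set M → Set M)ᵒᵈ) (monotoneAdmissibleFamilies 𝓗)
    (fun c hc hchain A₀ hA₀ => ?_) X hX
  have himage : ∀ H, IsChain (· ⊆ ·) ((fun A : Set M → Set M => A H) '' c) := by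
    rintro H _ ⟨A, hA, rfl⟩ _ ⟨B, hB, rfl⟩ _
    exact (hchain.total hA hB).symm.imp (fun h => h H) (fun h => h H)
  refine ⟨fun H => ⋂₀ ((fun A : Set M → Set M => A H) '' c), ⟨fun H hH => ?_, fun H hH => ?_,
    fun H hH K hK hHK => ?_⟩, fun A hA H => sInter_subset_of_mem (mem_image_of_mem _ hA)⟩
  · exact (h𝓗 H hH).sInter_nonempty hcompact (himage H)
      (forall_mem_image.2 fun A hA => (hc hA).2.1 H hH)
      (forall_mem_image.2 fun A hA => (hc hA).1 H hH)
  · exact admissibleIn_sInter ⟨_, mem_image_of_mem _ hA₀⟩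
      (forall_mem_image.2 fun A hA => (hc hA).2.1 H hH)
  · exact fun x hx => forall_mem_image.2 fun A hA =>
      (hc hA).2.2 hH hK hHK (hx _ (mem_image_of_mem _ hA))

/-- For a minimal family, a ball centered in `K` that contains `A K` contains every `A H`
with `K ⊆ H`. -/
theorem subset_closedBall_of_minimal (hchain : IsChain (· ⊆ ·) 𝓗) {A : Set M → Set M}
    (hA : Minimal (· ∈ monotoneAdmissibleFamilies 𝓗) A) {H K : Set M} (hK : K ∈ 𝓗)
    (hKH : K ⊆ H) {x : M} (hx : x ∈ K) {r : ℝ} (hr : A K ⊆ closedBall x r) :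
    A H ⊆ closedBall x r := by
  obtain ⟨hne, hadm, hmono⟩ := hA.prop
  have hmem : (fun L => {y ∈ A L | K ⊆ L → y ∈ closedBall x r}) ∈
      monotoneAdmissibleFamilies 𝓗 := by
    refine ⟨fun L hL => ?_, fun L hL => ?_, fun L hL L' hL' hLL' y hy =>
      ⟨hmono hL hL' hLL' hy.1, fun _ => ?_⟩⟩
    · by_cases h : K ⊆ L
      · exact (hne K hK).mono fun y hy => ⟨hmono hK hL h hy, fun _ => hr hy⟩
      · simpa [h] using hne L hL
    · by_cases h : K ⊆ L
      · simpa [h, inter_def] using (hadm L hL).inter_closedBall (h hx) r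
      · simpa [h] using hadm L hL
    · obtain h | h := hchain.total hK hL
      · exact hy.2 h
      · exact hr (hmono hL hK h hy.1)
  exact fun y hy => (hA.le_of_le hmem (fun L => sep_subset _ _) H hy).2 hKH

theorem subsingleton_of_minimal (hM : Bornology.IsBounded (univ : Set M))
    (hns : MetricNormalStructure M) (hchain : IsChain (· ⊆ ·) 𝓗)
    (h𝓗 : ∀ H ∈ 𝓗, OneLocalRetract H) (huniv : univ ∈ 𝓗) {A : Set M → Set M}
    (hA : Minimal (· ∈ monotoneAdmissibleFamilies 𝓗) A) : (A univ).Subsingleton := by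
  obtain ⟨hne, hadm, hmono⟩ := hA.prop
  by_contra hA'
  obtain ⟨z, hz, r, hzr, a, ha, har⟩ := hns.exists_center hM (not_subsingleton_iff.1 hA')
  have hzA : z ∈ A univ := (hadm univ huniv).2 ⟨mem_univ z, hz⟩
  have hmem : (fun H => {x ∈ A H | A H ⊆ closedBall x r}) ∈ monotoneAdmissibleFamilies 𝓗 := by
    refine ⟨fun H hH => ?_, fun H hH => (hadm H hH).centers r, fun H hH K hK hHK x hx =>
      ⟨hmono hH hK hHK hx.1,
        subset_closedBall_of_minimal hchain hA hH hHK ((hadm H hH).1 hx.1) hx.2⟩⟩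
    refine (h𝓗 H hH).centers_nonempty (hadm H hH) (fun x hx s hs => ?_)
      ((hmono hH huniv (subset_univ H)).trans hzr)
    exact subset_closedBall_of_minimal hchain hA hH (subset_univ H) hx hs hzA
  exact har (hA.le_of_le hmem (fun H => sep_subset _ _) univ ha).2

theorem oneLocalRetract_sInter [Nonempty M] (hM : Bornology.IsBounded (univ : Set M))
    (hns : MetricNormalStructure M) (hcompact : AdmissibleCompact M)
    (hchain : IsChain (· ⊆ ·) 𝓗) (h𝓗 : ∀ H ∈ 𝓗, OneLocalRetract H) :
    OneLocalRetract (⋂₀ 𝓗) := by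
  intro C hC hCne
  have hchain' : IsChain (· ⊆ ·) (insert univ 𝓗) :=
    hchain.insert fun H _ _ => .inr (subset_univ H)
  have h𝓗' : ∀ H ∈ insert univ 𝓗, OneLocalRetract H :=
    forall_mem_insert.2 ⟨oneLocalRetract_univ, h𝓗⟩
  have hCH : ∀ H ∈ insert univ 𝓗, ∀ p ∈ C, p.1 ∈ H :=
    forall_mem_insert.2 ⟨fun p _ => mem_univ _, fun H hH p hp => hC p hp H hH⟩
  obtain ⟨A, hAX, hA⟩ := exists_minimal_monotoneAdmissibleFamily hcompact h𝓗'
    (X := fun H => (⋂ p ∈ C, closedBall p.1 p.2) ∩ H)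
    ⟨fun H hH => h𝓗' H hH C (hCH H hH) hCne,
      fun H hH => admissibleIn_inter_iInter_closedBall (hCH H hH),
      fun H _ K _ hHK => inter_subset_inter_right _ hHK⟩
  have huniv := mem_insert univ 𝓗
  have hsing := subsingleton_of_minimal hM hns hchain' h𝓗' huniv hA
  obtain ⟨hne, hadm, hmono⟩ := hA.prop
  obtain ⟨a, ha⟩ := hne univ huniv
  refine ⟨a, (hAX univ ha).1, fun H hH => ?_⟩
  have hH' := mem_insert_of_mem univ hH
  obtain ⟨b, hb⟩ := hne H hH'
  rw [hsing ha (hmono hH' huniv (subset_univ H) hb)]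
  exact (hadm H hH').1 hb

end Chains

theorem stmt4 {M : Type*} [MetricSpace M] [Nonempty M]
    (hM : Bornology.IsBounded (Set.univ : Set M))
    (hns : MetricNormalStructure M) (hcompact : AdmissibleCompact M)
    {I : Type*} (T : I → M → M)
    (hcomm : ∀ i j : I, T i ∘ T j = T j ∘ T i)
    (hone : ∀ i : I, OrbitNonexpansive (T i)) :
    (∃ x : M, ∀ i : I, T i x = x) ∧ OneLocalRetract {x : M | ∀ i : I, T i x = x} := by
  suffices h : OneLocalRetract {x : M | ∀ i : I, T i x = x} by
    obtain ⟨x, -, hx⟩ := h ∅ (by simp) (by simp)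
    exact ⟨⟨x, hx⟩, h⟩
  obtain ⟨J, -, hJ⟩ := zorn_subset_nonempty
    {J : Set I | OneLocalRetract {x : M | ∀ i ∈ J, T i x = x}} (fun c hc hchain _ => by
      refine ⟨⋃₀ c, ?_, fun J hJ => subset_sUnion_of_mem hJ⟩
      have hunion : {x : M | ∀ i ∈ ⋃₀ c, T i x = x} =
          ⋂₀ ((fun J : Set I => {x : M | ∀ i ∈ J, T i x = x}) '' c) := by
        ext x
        simp only [mem_sUnion, sInter_image, mem_iInter, mem_ofPred_eq]
        exact ⟨fun h J hJ i hi => h i ⟨J, hJ, hi⟩, fun h i ⟨J, hJ, hi⟩ => h J hJ i hi⟩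
      rw [mem_ofPred_eq, hunion]
      refine oneLocalRetract_sInter hM hns hcompact ?_ (forall_mem_image.2 fun J hJ => hc hJ)
      rintro _ ⟨J, hJ, rfl⟩ _ ⟨K, hK, rfl⟩ _
      exact (hchain.total hJ hK).symm.imp (fun h x hx i hi => hx i (h hi))
        fun h x hx i hi => hx i (h hi)) ∅ (by simpa using oneLocalRetract_univ)
  have hall : ∀ i, i ∈ J := fun i => by
    have hinsert : OneLocalRetract {x : M | ∀ j ∈ insert i J, T j x = x} := by
      simp only [forall_mem_insert, and_comm (a := T i _ = _)]
      refine OneLocalRetract.inter_fixedPoints hM hns hcompact hJ.prop (fun x hx j hj => ?_)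
        (hone i)
      rw [← Function.comp_apply (f := T j), hcomm j i, Function.comp_apply, hx j hj]
    exact hJ.le_of_ge hinsert (subset_insert i J) (mem_insert i J)
  simpa [hall] using hJ.prop
end

section
/- Let (M,d) be a bounded metric space and T : M → M an orbit-nonexpansive mapping. Then for all x, y ∈ M and all n ∈ ℕ, d(T^n x, T^n y) ≤ D(x, o_T(y)). -/
open Metric Set

theorem dist_iterate_le_Dsup {M : Type*} [MetricSpace M]
    (hM : Bornology.IsBounded (Set.univ : Set M)) (x y : M) (T : M → M) (m : ℕ) :
    dist x (T^[m] y) ≤ Dsup x (orbitOf T y) := by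
  obtain ⟨C, hC⟩ := Metric.isBounded_iff.1 hM
  refine le_csSup ⟨C, ?_⟩ ⟨_, ⟨m, rfl⟩, rfl⟩
  rintro _ ⟨a, -, rfl⟩
  exact hC (mem_univ _) (mem_univ _)

theorem Dsup_orbitOf_le {M : Type*} [MetricSpace M] {x y : M} {T : M → M} {r : ℝ}
    (h : ∀ k : ℕ, dist x (T^[k] y) ≤ r) : Dsup x (orbitOf T y) ≤ r := by
  refine csSup_le ⟨_, _, ⟨0, rfl⟩, rfl⟩ ?_
  rintro _ ⟨_, ⟨k, rfl⟩, rfl⟩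
  exact h k

theorem OrbitNonexpansive.dist_iterate_iterate_le {M : Type*} [MetricSpace M]
    (hM : Bornology.IsBounded (Set.univ : Set M)) {T : M → M} (hT : OrbitNonexpansive T)
    (x y : M) {n m : ℕ} (hnm : n ≤ m) :
    dist (T^[n] x) (T^[m] y) ≤ Dsup x (orbitOf T y) := by
  induction n generalizing m with
  | zero => exact dist_iterate_le_Dsup hM x y T m
  | succ n ih =>
    obtain ⟨m, rfl⟩ : ∃ j, m = j + 1 := ⟨m - 1, by omega⟩
    rw [Function.iterate_succ_apply', Function.iterate_succ_apply']
    refine (hT _ _).trans (Dsup_orbitOf_le fun k => ?_)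
    rw [← Function.iterate_add_apply]
    exact ih (by omega)

theorem stmt14 {M : Type*} [MetricSpace M]
    (hM : Bornology.IsBounded (Set.univ : Set M))
    (T : M → M) (hT : OrbitNonexpansive T) :
    ∀ x y : M, ∀ n : ℕ, dist (T^[n] x) (T^[n] y) ≤ Dsup x (orbitOf T y) := by
  exact fun x y n => hT.dist_iterate_iterate_le hM x y le_rfl
end
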